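/- Let c₁, c₂, c₃, c₄, c₅, c₆ be real constants satisfying 4·e^(2c₁) = c₂² + c₄². Define γ₁(s) = e^(−c₁)·c₂·arctan(e^(s−c₁)) + c₃, γ₂(s) = e^(−c₁)·c₄·arctan(e^(s−c₁)) + c₅, γ₃(s) = −s + ln(e^(2s) + e^(2c₁)) + c₆ for s ∈ ℝ. Then the curve γ = (γ₁, γ₂, γ₃) is unit speed: (γ₁'(s))² + (γ₂'(s))² + (γ₃'(s))² = 1 for all s ∈ ℝ. -/

import Mathlib

lemma hasDerivAt_exp_mul_arctan_exp (a b d s : ℝ) :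
    HasDerivAt (fun s => Real.exp (-a) * b * Real.arctan (Real.exp (s - a)) + d)
      (b * Real.exp s / (Real.exp s ^ 2 + Real.exp a ^ 2)) s := by
  refine ((((hasDerivAt_id' s).sub_const a).exp.arctan.const_mul
    (Real.exp (-a) * b)).add_const d).congr_deriv ?_
  have ha := Real.exp_pos a
  have hs := Real.exp_pos s
  simp only [Real.exp_sub, Real.exp_neg]
  field_simp
  ring

lemma hasDerivAt_neg_add_log_exp_add_exp (a d s : ℝ) :
    HasDerivAt (fun s => -s + Real.log (Real.exp (2 * s) + Real.exp (2 * a)) + d)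
      ((Real.exp s ^ 2 - Real.exp a ^ 2) / (Real.exp s ^ 2 + Real.exp a ^ 2)) s := by
  have hpos : 0 < Real.exp (2 * s) + Real.exp (2 * a) := by positivity
  refine (((hasDerivAt_id' s).neg.add
    ((((hasDerivAt_id' s).const_mul 2).exp.add_const (Real.exp (2 * a))).log
      hpos.ne')).add_const d).congr_deriv ?_
  have ha := Real.exp_pos a
  have hs := Real.exp_pos s
  simp only [two_mul, Real.exp_add]
  field_simp
  ring

theorem stmt_1 (c₁ c₂ c₃ c₄ c₅ c₆ : ℝ)
    (hc : 4 * Real.exp (2 * c₁) = c₂ ^ 2 + c₄ ^ 2)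
    (γ₁ γ₂ γ₃ : ℝ → ℝ)
    (hγ₁ : γ₁ = fun s => Real.exp (-c₁) * c₂ * Real.arctan (Real.exp (s - c₁)) + c₃)
    (hγ₂ : γ₂ = fun s => Real.exp (-c₁) * c₄ * Real.arctan (Real.exp (s - c₁)) + c₅)
    (hγ₃ : γ₃ = fun s => -s + Real.log (Real.exp (2 * s) + Real.exp (2 * c₁)) + c₆) :
    ∀ s : ℝ, (deriv γ₁ s) ^ 2 + (deriv γ₂ s) ^ 2 + (deriv γ₃ s) ^ 2 = 1 := by
  intro s
  rw [hγ₁, hγ₂, hγ₃, (hasDerivAt_exp_mul_arctan_exp c₁ c₂ c₃ s).deriv,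
    (hasDerivAt_exp_mul_arctan_exp c₁ c₄ c₅ s).deriv,
    (hasDerivAt_neg_add_log_exp_add_exp c₁ c₆ s).deriv]
  have hpos : 0 < Real.exp s ^ 2 + Real.exp c₁ ^ 2 := by positivity
  rw [two_mul, Real.exp_add] at hc
  field_simp
  linear_combination -Real.exp s ^ 2 * hc
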